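/- Let n ≥ 2, β > -2/n, and λ distributed as the Gaussian beta ensemble on ℝⁿ. Then (1/2)(p₂(λ) - p₁(λ)²/n) has the Gamma((d(β,n)-1)/2, 1) distribution, where d(β,n) = n + n(n-1)β/2. -/

import Mathlib

open MeasureTheory ProbabilityTheory Real

/-- Two random variables whose moment generating functions are finite and agree on a convex
neighbourhood of `0` have the same law. -/
theorem map_eq_map_of_mgf_eqOn {Ω Ω' : Type*} {mΩ : MeasurableSpace Ω}
    {mΩ' : MeasurableSpace Ω'} {μ : Measure Ω} {ν : Measure Ω'} [IsFiniteMeasure μ]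
    [IsFiniteMeasure ν] {X : Ω → ℝ} {Y : Ω' → ℝ} (hX : AEMeasurable X μ) (hY : AEMeasurable Y ν)
    {s : Set ℝ} (hs : IsOpen s) (hconv : Convex ℝ s) (h0 : 0 ∈ s)
    (hsX : s ⊆ integrableExpSet X μ) (hsY : s ⊆ integrableExpSet Y ν)
    (h : ∀ t ∈ s, mgf X μ t = mgf Y ν t) :
    μ.map X = ν.map Y := by
  have hXa : AnalyticOnNhd ℂ (complexMGF X μ) {z | z.re ∈ s} :=
    analyticOnNhd_complexMGF.mono fun z hz => interior_maximal hsX hs hz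
  have hYa : AnalyticOnNhd ℂ (complexMGF Y ν) {z | z.re ∈ s} :=
    analyticOnNhd_complexMGF.mono fun z hz => interior_maximal hsY hs hz
  have heq : Set.EqOn (complexMGF X μ) (complexMGF Y ν) {z | z.re ∈ s} := by
    refine hXa.eqOn_of_preconnected_of_frequently_eq hYa
      (hconv.linear_preimage Complex.reLm).isPreconnected (z₀ := ((0 : ℝ) : ℂ)) (by simpa) ?_
    have h_real : ∃ᶠ x : ℝ in nhdsWithin 0 {0}ᶜ, complexMGF X μ x = complexMGF Y ν x := by
      refine Filter.Eventually.frequently ?_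
      filter_upwards [nhdsWithin_le_nhds (hs.mem_nhds h0)] with t ht
      rw [complexMGF_ofReal, complexMGF_ofReal, h t ht]
    refine Filter.Tendsto.frequently (f := fun x : ℝ => (x : ℂ)) ?_ h_real
    refine tendsto_nhdsWithin_iff.2 ⟨?_, ?_⟩
    · exact Complex.continuous_ofReal.continuousAt.mono_left nhdsWithin_le_nhds
    · filter_upwards [self_mem_nhdsWithin] with x hx
      simpa using hx
  refine Measure.ext_of_charFun (funext fun t => ?_)
  rw [← complexMGF_mul_I hX, ← complexMGF_mul_I hY]
  exact heq (by simpa)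

theorem mgf_id_gammaMeasure {a t : ℝ} (ha : 0 < a) (ht : t < 1) :
    mgf id (gammaMeasure a 1) t = (1 / (1 - t)) ^ a := by
  have hmeas : Measurable (gammaPDF a 1) := (measurable_gammaPDFReal a 1).ennreal_ofReal
  rw [mgf, gammaMeasure, integral_withDensity_eq_integral_toReal_smul hmeas (by simp [gammaPDF])]
  have key := integral_rpow_mul_exp_neg_mul_Ioi ha (sub_pos.2 ht)
  have hind : (fun x => (gammaPDF a 1 x).toReal • exp (t * id x)) = (Set.Ici (0 : ℝ)).indicator
      fun x => (Gamma a)⁻¹ * (x ^ (a - 1) * exp (-((1 - t) * x))) := by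
    funext x
    rw [gammaPDF, ENNReal.toReal_ofReal (gammaPDFReal_nonneg ha one_pos x), gammaPDFReal]
    by_cases hx : 0 ≤ x
    · rw [Set.indicator_of_mem (Set.mem_Ici.2 hx), if_pos hx,
        show -((1 - t) * x) = -(1 * x) + t * x by ring, exp_add]
      simp only [one_rpow, id, smul_eq_mul]
      ring
    · simp [hx]
  rw [hind, integral_indicator measurableSet_Ici, integral_Ici_eq_integral_Ioi,
    integral_const_mul, key]
  have := (Gamma_pos_of_pos ha).ne'
  field_simp

theorem integrable_abs_rpow_mul_exp_neg_mul_sq {b γ : ℝ} (hb : 0 < b) (hγ : -1 < γ) :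
    Integrable fun x : ℝ => |x| ^ γ * exp (-b * x ^ 2) := by
  have hpos : IntegrableOn (fun x : ℝ => |x| ^ γ * exp (-b * x ^ 2)) (Set.Ioi 0) :=
    (integrableOn_rpow_mul_exp_neg_mul_sq hb hγ).congr_fun
      (fun x hx => by simp only [abs_of_pos (Set.mem_Ioi.1 hx)]) measurableSet_Ioi
  have hneg : IntegrableOn (fun x : ℝ => |x| ^ γ * exp (-b * x ^ 2)) (Set.Iic 0) := by
    have hemb : MeasurableEmbedding (Neg.neg : ℝ → ℝ) := (Homeomorph.neg ℝ).measurableEmbedding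
    rw [← Measure.map_neg_eq_self (volume : Measure ℝ), hemb.integrableOn_map_iff]
    simp only [Function.comp_def, abs_neg, neg_sq, Set.neg_preimage,
      Set.neg_Iic, neg_zero]
    exact (integrableOn_Ici_iff_integrableOn_Ioi (by simp)).2 hpos
  rw [← integrableOn_univ, ← Set.Iic_union_Ioi (a := (0 : ℝ))]
  exact hneg.union hpos

theorem integrable_comp_linearMap {E : Type*} [NormedAddCommGroup E] [NormedSpace ℝ E]
    [MeasurableSpace E] [BorelSpace E] [FiniteDimensional ℝ E] {μ : Measure E}
    [μ.IsAddHaarMeasure] {T : E →ₗ[ℝ] E} (hT : LinearMap.det T ≠ 0) {g : E → ℝ}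
    (hg : Integrable g μ) : Integrable (fun x => g (T x)) μ := by
  have hmap := Measure.map_linearMap_addHaar_eq_smul_addHaar μ hT
  refine Integrable.comp_measurable (g := g) ?_ T.continuous_of_finiteDimensional.measurable
  rw [hmap]
  exact hg.smul_measure ENNReal.ofReal_ne_top

theorem integral_comp_linearMap {E : Type*} [NormedAddCommGroup E] [NormedSpace ℝ E]
    [MeasurableSpace E] [BorelSpace E] [FiniteDimensional ℝ E] {μ : Measure E}
    [μ.IsAddHaarMeasure] {T : E →ₗ[ℝ] E} (hT : LinearMap.det T ≠ 0) {g : E → ℝ}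
    (hg : AEStronglyMeasurable g μ) :
    ∫ x, g (T x) ∂μ = |(LinearMap.det T)⁻¹| * ∫ x, g x ∂μ := by
  have hmap := Measure.map_linearMap_addHaar_eq_smul_addHaar μ hT
  rw [← integral_map T.continuous_of_finiteDimensional.aemeasurable, hmap, integral_smul_measure,
    ENNReal.toReal_ofReal (abs_nonneg _), smul_eq_mul]
  rw [hmap]
  exact hg.smul_measure _

/-- The off-diagonal product of a symmetric function is the square of its product over the pairs
`i < j`. -/
@[to_additive]
theorem prod_prod_erase_eq_sq_of_symm {ι M : Type*} [Fintype ι] [LinearOrder ι] [CommMonoid M]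
    (f : ι → ι → M) (hf : ∀ i j, f i j = f j i) :
    ∏ i, ∏ j ∈ Finset.univ.erase i, f i j =
      (∏ p ∈ Finset.univ.filter (fun p : ι × ι => p.1 < p.2), f p.1 p.2) ^ 2 := by
  have hswap : ∏ p ∈ Finset.univ.filter (fun p : ι × ι => p.2 < p.1), f p.1 p.2 =
      ∏ p ∈ Finset.univ.filter (fun p : ι × ι => p.1 < p.2), f p.1 p.2 :=
    Finset.prod_equiv (Equiv.prodComm ι ι) (by simp) fun p _ => by simp [hf p.1 p.2]
  rw [sq]
  nth_rewrite 2 [← hswap]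
  rw [← Finset.prod_union, ← Finset.filter_or, Finset.prod_filter, Fintype.prod_prod_type]
  · refine Finset.prod_congr rfl fun i _ => ?_
    rw [← Finset.prod_filter]
    refine Finset.prod_congr ?_ fun _ _ => rfl
    ext j
    simp [lt_or_lt_iff_ne, eq_comm]
  · exact Finset.disjoint_filter.2 fun p _ h => h.not_gt

/-- The unnormalized density of the Gaussian beta ensemble. -/
noncomputable def gbeWeight (n : ℕ) (β : ℝ) (l : Fin n → ℝ) : ℝ :=
  |∏ p ∈ Finset.univ.filter (fun p : Fin n × Fin n => p.1 < p.2), (l p.2 - l p.1)| ^ β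
    * Real.exp (-(∑ j, l j ^ 2) / 2)

theorem measurable_gbeWeight (n : ℕ) (β : ℝ) : Measurable (gbeWeight n β) := by
  unfold gbeWeight
  fun_prop

theorem gbeWeight_nonneg (n : ℕ) (β : ℝ) (l : Fin n → ℝ) : 0 ≤ gbeWeight n β l := by
  unfold gbeWeight
  positivity

theorem abs_prod_rpow_le_sum_star {n : ℕ} (hn : n ≠ 0) (β : ℝ) (l : Fin n → ℝ) :
    |∏ p ∈ Finset.univ.filter (fun p : Fin n × Fin n => p.1 < p.2), (l p.2 - l p.1)| ^ β ≤
      ∑ i, (n : ℝ)⁻¹ * ∏ j ∈ Finset.univ.erase i, |l j - l i| ^ (n * β / 2) := by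
  have hn' : (n : ℝ) ≠ 0 := Nat.cast_ne_zero.2 hn
  have hsq := prod_prod_erase_eq_sq_of_symm (fun i j => |l j - l i|) fun i j => abs_sub_comm _ _
  rw [← Finset.abs_prod] at hsq
  have hstar (i : Fin n) : 0 ≤ ∏ j ∈ Finset.univ.erase i, |l j - l i| :=
    Finset.prod_nonneg fun _ _ => abs_nonneg _
  calc _ = ∏ i, (∏ j ∈ Finset.univ.erase i, |l j - l i| ^ (n * β / 2)) ^ (n : ℝ)⁻¹ := by
        rw [show β = (2 : ℕ) * (β / 2) by push_cast; ring, rpow_mul (abs_nonneg _), rpow_natCast,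
          ← hsq, ← Real.finsetProd_rpow _ _ fun i _ => hstar i]
        refine Finset.prod_congr rfl fun i _ => ?_
        rw [Real.finsetProd_rpow _ _ fun _ _ => abs_nonneg _, ← rpow_mul (hstar i)]
        congr 1
        push_cast
        field_simp
    _ ≤ _ := by
        refine Real.geom_mean_le_arith_mean_weighted _ _ _ (fun _ _ => by positivity) ?_
          fun i _ => Finset.prod_nonneg fun _ _ => rpow_nonneg (abs_nonneg _) _
        simp [hn']

/-- The coordinates of a configuration relative to its `i`-th point. -/
noncomputable def relativeTo {ι : Type*} [DecidableEq ι] (i : ι) : (ι → ℝ) →ₗ[ℝ] (ι → ℝ) where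
  toFun l j := l j - if j = i then 0 else l i
  map_add' l m := by
    funext j
    by_cases hj : j = i <;> simp [hj, add_sub_add_comm]
  map_smul' c l := by
    funext j
    by_cases hj : j = i <;> simp [hj, mul_sub]

theorem relativeTo_apply_self {ι : Type*} [DecidableEq ι] (i : ι) (l : ι → ℝ) :
    relativeTo i l i = l i := by
  simp [relativeTo]

theorem relativeTo_apply_of_ne {ι : Type*} [DecidableEq ι] {i j : ι} (hj : j ≠ i) (l : ι → ℝ) :
    relativeTo i l j = l j - l i := by
  simp [relativeTo, hj]

theorem det_relativeTo_ne_zero {ι : Type*} [Fintype ι] [DecidableEq ι] (i : ι) :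
    LinearMap.det (relativeTo i) ≠ 0 := by
  refine (LinearMap.isUnit_det _ ((LinearMap.isUnit_iff_ker_eq_bot _).2 ?_)).ne_zero
  refine LinearMap.ker_eq_bot'.2 fun l hl => ?_
  have hi : l i = 0 := by rw [← relativeTo_apply_self i l, hl, Pi.zero_apply]
  funext j
  by_cases hj : j = i
  · rw [hj, hi, Pi.zero_apply]
  · have := congrFun hl j
    rw [relativeTo_apply_of_ne hj, hi, sub_zero] at this
    exact this

theorem integrable_star_mul_exp {n : ℕ} (hn : n ≠ 0) {γ : ℝ} (hγ : -1 < γ) (i : Fin n) :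
    Integrable fun l : Fin n → ℝ =>
      (∏ j ∈ Finset.univ.erase i, |l j - l i| ^ γ) * exp (-(∑ j, l j ^ 2) / 2) := by
  have hn1 : (1 : ℝ) ≤ n := Nat.one_le_cast.2 (Nat.one_le_iff_ne_zero.2 hn)
  set b : ℝ := 1 / (16 * n) with hb
  have hbpos : 0 < b := by positivity
  let g : Fin n → ℝ → ℝ := fun j u =>
    if j = i then exp (-(1 / 8) * u ^ 2) else |u| ^ γ * exp (-b * u ^ 2)
  have hg : Integrable fun l : Fin n → ℝ => ∏ j, g j (l j) := by
    refine Integrable.fintype_prod fun j => ?_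
    by_cases hj : j = i
    · simpa [g, hj] using integrable_exp_neg_mul_sq (b := 1 / 8) (by norm_num)
    · simpa [g, hj] using integrable_abs_rpow_mul_exp_neg_mul_sq hbpos hγ
  refine (integrable_comp_linearMap (det_relativeTo_ne_zero i) hg).mono'
    (by fun_prop) (Filter.Eventually.of_forall fun l => ?_)
  have hprod : ∏ j, g j (relativeTo i l j) = (∏ j ∈ Finset.univ.erase i, |l j - l i| ^ γ) *
      exp (-(1 / 8) * l i ^ 2 + ∑ j ∈ Finset.univ.erase i, -b * (l j - l i) ^ 2) := by
    rw [← Finset.mul_prod_erase _ _ (Finset.mem_univ i), exp_add, exp_sum, mul_left_comm,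
      ← Finset.prod_mul_distrib]
    congr 1
    · simp [g, relativeTo_apply_self]
    · refine Finset.prod_congr rfl fun j hj => ?_
      have hji := Finset.ne_of_mem_erase hj
      simp [g, hji, relativeTo_apply_of_ne hji]
  have hstar : 0 ≤ ∏ j ∈ Finset.univ.erase i, |l j - l i| ^ γ :=
    Finset.prod_nonneg fun _ _ => rpow_nonneg (abs_nonneg _) _
  rw [hprod, norm_of_nonneg (by positivity)]
  refine mul_le_mul_of_nonneg_left (exp_le_exp.2 ?_) hstar
  have hsum : ∑ j ∈ Finset.univ.erase i, (l j - l i) ^ 2 ≤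
      2 * ∑ j, l j ^ 2 + 2 * n * l i ^ 2 :=
    calc _ ≤ ∑ j, (l j - l i) ^ 2 :=
          Finset.sum_le_sum_of_subset_of_nonneg (Finset.erase_subset _ _) fun _ _ _ => sq_nonneg _
      _ ≤ ∑ j, (2 * l j ^ 2 + 2 * l i ^ 2) :=
          Finset.sum_le_sum fun j _ => by nlinarith [sq_nonneg (l j + l i)]
      _ = _ := by
          rw [Finset.sum_add_distrib, ← Finset.mul_sum]
          simp
          ring
  have hi : l i ^ 2 ≤ ∑ j, l j ^ 2 :=
    Finset.single_le_sum (f := fun j => l j ^ 2) (fun _ _ => sq_nonneg _) (Finset.mem_univ i)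
  rw [← Finset.mul_sum]
  have hbn : b * n = 1 / 16 := by rw [hb]; field_simp
  have hb16 : b ≤ 1 / 16 := by nlinarith
  have hS : 0 ≤ ∑ j, l j ^ 2 := Finset.sum_nonneg fun _ _ => sq_nonneg _
  have h1 := mul_le_mul_of_nonneg_left hsum hbpos.le
  have h2 := mul_le_mul_of_nonneg_right hb16 hS
  have h3 : b * (2 * n * l i ^ 2) = l i ^ 2 / 8 := by
    rw [show b * (2 * n * l i ^ 2) = (b * n) * 2 * l i ^ 2 by ring, hbn]
    ring
  linarith

theorem integrable_gbeWeight {n : ℕ} (hn : n ≠ 0) {β : ℝ} (hβ : -2 / n < β) :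
    Integrable (gbeWeight n β) := by
  have hn0 : (0 : ℝ) < n := Nat.cast_pos.2 (Nat.pos_of_ne_zero hn)
  have hγ : -1 < n * β / 2 := by
    rw [div_lt_iff₀ hn0] at hβ
    linarith
  refine (integrable_finsetSum Finset.univ fun i _ =>
    (integrable_star_mul_exp hn hγ i).const_mul (n : ℝ)⁻¹).mono'
    (measurable_gbeWeight n β).aestronglyMeasurable (Filter.Eventually.of_forall fun l => ?_)
  rw [norm_of_nonneg (gbeWeight_nonneg n β l), gbeWeight]
  simp_rw [← mul_assoc, ← Finset.sum_mul]
  exact mul_le_mul_of_nonneg_right (abs_prod_rpow_le_sum_star hn β l) (exp_pos _).le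

theorem integral_gbeWeight_pos {n : ℕ} (hn : n ≠ 0) {β : ℝ} (hβ : -2 / n < β) :
    0 < ∫ l, gbeWeight n β l := by
  rw [integral_pos_iff_support_of_nonneg (gbeWeight_nonneg n β) (integrable_gbeWeight hn hβ)]
  have hopen : IsOpen {l : Fin n → ℝ |
      ∏ p ∈ Finset.univ.filter (fun p : Fin n × Fin n => p.1 < p.2), (l p.2 - l p.1) ≠ 0} :=
    isOpen_ne_fun (by fun_prop) continuous_const
  refine (hopen.measure_pos volume ⟨fun i => (i : ℝ), ?_⟩).trans_le (measure_mono fun l hl => ?_)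
  · refine Finset.prod_ne_zero_iff.2 fun p hp => sub_ne_zero.2 ?_
    have hlt : (p.1 : ℕ) < p.2 := (Finset.mem_filter.1 hp).2
    exact Nat.cast_injective.ne hlt.ne'
  · have := abs_pos.2 hl
    exact ne_of_gt (by unfold gbeWeight; positivity)

/-- The linear map dilating a configuration by `s` about its mean. -/
noncomputable def dilationAboutMean (n : ℕ) (s : ℝ) : (Fin n → ℝ) →ₗ[ℝ] (Fin n → ℝ) :=
  Matrix.toLin' (s • (1 + Matrix.replicateCol Unit (fun _ : Fin n => (1 - s) / (s * n)) *
    Matrix.replicateRow Unit fun _ : Fin n => (1 : ℝ)))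

theorem dilationAboutMean_apply {n : ℕ} {s : ℝ} (hs : s ≠ 0) (l : Fin n → ℝ) (j : Fin n) :
    dilationAboutMean n s l j = s * l j + (1 - s) / n * ∑ i, l i := by
  rw [dilationAboutMean, Matrix.toLin'_apply, Matrix.smul_mulVec, Matrix.add_mulVec,
    Matrix.one_mulVec]
  simp only [Pi.smul_apply, Pi.add_apply, Matrix.mulVec, dotProduct, Matrix.mul_apply,
    Matrix.replicateCol_apply, Matrix.replicateRow_apply, Finset.univ_unique, Finset.sum_singleton,
    mul_one, ← Finset.mul_sum, smul_eq_mul]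
  field_simp

theorem det_dilationAboutMean {n : ℕ} (hn : n ≠ 0) {s : ℝ} (hs : s ≠ 0) :
    LinearMap.det (dilationAboutMean n s) = s ^ n / s := by
  rw [dilationAboutMean, LinearMap.det_toLin', Matrix.det_smul,
    Matrix.det_one_add_replicateCol_mul_replicateRow]
  simp only [dotProduct, one_mul, Finset.sum_const, Finset.card_univ, Fintype.card_fin,
    nsmul_eq_mul]
  have : (n : ℝ) ≠ 0 := Nat.cast_ne_zero.2 hn
  field_simp
  ring

theorem card_filter_lt (n : ℕ) :
    ((Finset.univ.filter fun p : Fin n × Fin n => p.1 < p.2).card : ℝ) = n * (n - 1) / 2 := by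
  have h := sum_sum_erase_eq_sq_of_symm (fun _ _ : Fin n => (1 : ℝ)) fun _ _ => rfl
  rcases Nat.eq_zero_or_pos n with rfl | hn
  · simp
  simp [Nat.cast_sub (Nat.one_le_iff_ne_zero.2 hn.ne')] at h
  linarith

theorem sum_sq_dilationAboutMean {n : ℕ} (hn : n ≠ 0) {s : ℝ} (hs : s ≠ 0) (l : Fin n → ℝ) :
    ∑ j, dilationAboutMean n s l j ^ 2 =
      s ^ 2 * ∑ j, l j ^ 2 + (1 - s ^ 2) * ((∑ j, l j) ^ 2 / n) := by
  have : (n : ℝ) ≠ 0 := Nat.cast_ne_zero.2 hn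
  simp_rw [dilationAboutMean_apply hs, add_sq, Finset.sum_add_distrib, mul_pow, ← Finset.sum_mul,
    ← Finset.mul_sum]
  simp only [Finset.sum_const, Finset.card_univ, Fintype.card_fin, nsmul_eq_mul]
  field_simp
  ring

theorem gbeWeight_dilationAboutMean {n : ℕ} (hn : n ≠ 0) (β : ℝ) {s : ℝ} (hs : 0 < s)
    (l : Fin n → ℝ) :
    gbeWeight n β (dilationAboutMean n s l) = s ^ (n * (n - 1) / 2 * β) *
      (gbeWeight n β l * exp ((1 - s ^ 2) * (((∑ j, l j ^ 2) - (∑ j, l j) ^ 2 / n) / 2))) := by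
  have hprod : ∏ p ∈ Finset.univ.filter (fun p : Fin n × Fin n => p.1 < p.2),
      (dilationAboutMean n s l p.2 - dilationAboutMean n s l p.1) =
      s ^ (Finset.univ.filter fun p : Fin n × Fin n => p.1 < p.2).card *
      ∏ p ∈ Finset.univ.filter (fun p : Fin n × Fin n => p.1 < p.2), (l p.2 - l p.1) := by
    rw [← Finset.prod_const, ← Finset.prod_mul_distrib]
    refine Finset.prod_congr rfl fun p _ => ?_
    rw [dilationAboutMean_apply hs.ne', dilationAboutMean_apply hs.ne']
    ring
  rw [gbeWeight, gbeWeight, hprod, abs_mul, abs_of_pos (pow_pos hs _),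
    mul_rpow (pow_pos hs _).le (abs_nonneg _), ← rpow_natCast, ← rpow_mul hs.le, card_filter_lt,
    mul_assoc, mul_assoc, ← exp_add, sum_sq_dilationAboutMean hn hs.ne']
  congr 3
  ring

theorem integral_gbeWeight_mul_exp {n : ℕ} (hn : n ≠ 0) (β : ℝ) {t : ℝ} (ht : t < 1) :
    ∫ l : Fin n → ℝ,
      gbeWeight n β l * exp (t * (((∑ j, l j ^ 2) - (∑ j, l j) ^ 2 / n) / 2)) =
      (1 / (1 - t)) ^ ((n + n * (n - 1) * β / 2 - 1) / 2) * ∫ l, gbeWeight n β l := by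
  obtain ⟨s, hs, rfl⟩ : ∃ s : ℝ, 0 < s ∧ t = 1 - s ^ 2 :=
    ⟨√(1 - t), sqrt_pos.2 (sub_pos.2 ht), by rw [sq_sqrt (sub_pos.2 ht).le]; ring⟩
  have hdet : LinearMap.det (dilationAboutMean n s) = s ^ ((n : ℝ) - 1) := by
    rw [det_dilationAboutMean hn hs.ne', rpow_sub_one hs.ne', rpow_natCast]
  have hpt (l : Fin n → ℝ) :
      gbeWeight n β l * exp ((1 - s ^ 2) * (((∑ j, l j ^ 2) - (∑ j, l j) ^ 2 / n) / 2)) =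
        s ^ (-(n * (n - 1) / 2 * β)) * gbeWeight n β (dilationAboutMean n s l) := by
    rw [gbeWeight_dilationAboutMean hn β hs, ← mul_assoc, ← rpow_add hs, neg_add_cancel,
      rpow_zero, one_mul]
  simp_rw [hpt]
  rw [integral_const_mul, integral_comp_linearMap (by rw [hdet]; positivity)
    (measurable_gbeWeight n β).aestronglyMeasurable, hdet, ← rpow_neg hs.le,
    abs_of_pos (rpow_pos_of_pos hs _), ← mul_assoc, ← rpow_add hs, sub_sub_cancel, one_div,
    ← rpow_natCast, ← rpow_neg hs.le, ← rpow_mul hs.le]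
  congr 2
  push_cast
  ring

/-- Under the GβE, `(p₂(λ) - p₁(λ)²/n)/2` has the `Gamma((d(β,n)-1)/2, 1)` distribution. -/
theorem gbe_centered_p2_gamma (n : ℕ) (hn : 2 ≤ n) (β : ℝ) (hβ : -2 / n < β)
    (Z : ℝ) (μ : Measure (Fin n → ℝ))
    (hZ : Z = ∫ l : Fin n → ℝ,
      |∏ p ∈ Finset.univ.filter (fun p : Fin n × Fin n => p.1 < p.2), (l p.2 - l p.1)| ^ β
        * Real.exp (-(∑ j, l j ^ 2) / 2))
    (hμ : μ = (volume : Measure (Fin n → ℝ)).withDensity fun l =>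
      ENNReal.ofReal (Z⁻¹ *
        (|∏ p ∈ Finset.univ.filter (fun p : Fin n × Fin n => p.1 < p.2), (l p.2 - l p.1)| ^ β
          * Real.exp (-(∑ j, l j ^ 2) / 2)))) :
    Measure.map (fun l => ((∑ j, l j ^ 2) - (∑ j, l j) ^ 2 / (n : ℝ)) / 2) μ = gammaMeasure ((n + n * (n - 1) * β / 2 - 1) / 2) 1 := by
  have hn0 : n ≠ 0 := by omega
  change Z = ∫ l, gbeWeight n β l at hZ
  change μ = volume.withDensity fun l => ENNReal.ofReal (Z⁻¹ * gbeWeight n β l) at hμ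
  have hZpos : 0 < Z := hZ ▸ integral_gbeWeight_pos hn0 hβ
  have ha : 0 < (n + n * (n - 1) * β / 2 - 1) / 2 := by
    have h2 : (2 : ℝ) ≤ n := by exact_mod_cast hn
    rw [div_lt_iff₀ (by linarith)] at hβ
    nlinarith
  set a : ℝ := (n + n * (n - 1) * β / 2 - 1) / 2 with ha_def
  have hdensity : Measurable fun l => ENNReal.ofReal (Z⁻¹ * gbeWeight n β l) :=
    ((measurable_gbeWeight n β).const_mul _).ennreal_ofReal
  have hmgf (t : ℝ) (ht : t < 1) :
      mgf (fun l => ((∑ j, l j ^ 2) - (∑ j, l j) ^ 2 / (n : ℝ)) / 2) μ t =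
        (1 / (1 - t)) ^ a := by
    rw [mgf, hμ, integral_withDensity_eq_integral_toReal_smul hdensity (by simp)]
    simp_rw [ENNReal.toReal_ofReal (mul_nonneg (inv_pos.2 hZpos).le (gbeWeight_nonneg n β _)),
      smul_eq_mul, mul_assoc]
    rw [integral_const_mul, integral_gbeWeight_mul_exp hn0 β ht, ← hZ, ← ha_def]
    field_simp
  have hpos (t : ℝ) (ht : t < 1) : (1 / (1 - t)) ^ a ≠ 0 :=
    (rpow_pos_of_pos (one_div_pos.2 (sub_pos.2 ht)) _).ne'
  have : IsFiniteMeasure μ := by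
    rw [hμ]
    exact isFiniteMeasure_withDensity_ofReal
      ((integrable_gbeWeight hn0 hβ).const_mul _).hasFiniteIntegral
  have := isProbabilityMeasure_gammaMeasure ha one_pos
  have hmap := map_eq_map_of_mgf_eqOn (μ := μ) (ν := gammaMeasure a 1)
    (X := fun l => ((∑ j, l j ^ 2) - (∑ j, l j) ^ 2 / (n : ℝ)) / 2) (Y := id)
    (by fun_prop) aemeasurable_id isOpen_Iio (convex_Iio 1) (Set.mem_Iio.2 one_pos)
    (fun t ht => Integrable.of_integral_ne_zero ((hmgf t ht).trans_ne (hpos t ht)))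
    (fun t ht => Integrable.of_integral_ne_zero
      ((mgf_id_gammaMeasure ha ht).trans_ne (hpos t ht)))
    (fun t ht => (hmgf t ht).trans (mgf_id_gammaMeasure ha ht).symm)
  rwa [Measure.map_id] at hmap
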